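/- arXiv:1905.11976 — 4 statements merged into one kernel-verified Lean document; each statement's English description precedes it below -/
import Mathlib

section
/- (Covariant r-matrix structure for sine-Gordon.) For all real (φ, φ_t, φ_x) and all λ, μ ∈ ℂ with λ ≠ 0, μ ≠ 0 and λ² ≠ μ², the sine-Gordon Lax matrices satisfy the two 4×4 matrix identities {U₁(φ,φ_t;λ), U₂(φ,φ_t;μ)}_S = −[r₁₂(λ,μ), U(φ,φ_t;λ)⊗I + I⊗U(φ,φ_t;μ)] and {V₁(φ,φ_x;λ), V₂(φ,φ_x;μ)}_T = [r₁₂(λ,μ), V(φ,φ_x;λ)⊗I + I⊗V(φ,φ_x;μ)]. Equivalently, the covariant Poisson bracket of the Lax form W(λ) = U(λ)dx + V(λ)dt, whose dx-component is −{U₁(λ),U₂(μ)}_S and whose dt-component is {V₁(λ),V₂(μ)}_T, equals [r₁₂(λ,μ), W₁(λ)+W₂(μ)] componentwise. -/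
noncomputable section

open Matrix Kronecker

def σ1 : Matrix (Fin 2) (Fin 2) ℂ := !![0, 1; 1, 0]
def σ2 : Matrix (Fin 2) (Fin 2) ℂ := !![0, -Complex.I; Complex.I, 0]
def σ3 : Matrix (Fin 2) (Fin 2) ℂ := !![1, 0; 0, -1]
def I2 : Matrix (Fin 2) (Fin 2) ℂ := 1

def k0 (m : ℝ) (lam : ℂ) : ℂ := (m / 4) * (lam + lam⁻¹)
def k1 (m : ℝ) (lam : ℂ) : ℂ := (m / 4) * (lam - lam⁻¹)

/-- sine-Gordon space Lax matrix as a function of (φ, φ_t) ∈ ℝ². -/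
def USG (m β : ℝ) (lam : ℂ) (w : ℝ × ℝ) : Matrix (Fin 2) (Fin 2) ℂ :=
  (-Complex.I * k0 m lam * Real.sin (β * w.1 / 2)) • σ1
    + (-Complex.I * k1 m lam * Real.cos (β * w.1 / 2)) • σ2
    + (-Complex.I * (β / 4) * w.2) • σ3

/-- sine-Gordon time Lax matrix as a function of (φ, φ_x) ∈ ℝ². -/
def VSG (m β : ℝ) (lam : ℂ) (w : ℝ × ℝ) : Matrix (Fin 2) (Fin 2) ℂ :=
  (-Complex.I * k1 m lam * Real.sin (β * w.1 / 2)) • σ1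
    + (-Complex.I * k0 m lam * Real.cos (β * w.1 / 2)) • σ2
    + (-Complex.I * (β / 4) * w.2) • σ3

/-- single-time (space) Poisson bracket of functions of (φ, φ_t):
{A,C}_S = (∂A/∂φ_t)(∂C/∂φ) − (∂A/∂φ)(∂C/∂φ_t). -/
def pbS (A C : ℝ × ℝ → ℂ) (p : ℝ × ℝ) : ℂ :=
  fderiv ℝ A p (0, 1) * fderiv ℝ C p (1, 0) - fderiv ℝ A p (1, 0) * fderiv ℝ C p (0, 1)

/-- single-time (time) Poisson bracket of functions of (φ, φ_x):
{B,D}_T = (∂B/∂φ)(∂D/∂φ_x) − (∂D/∂φ)(∂B/∂φ_x). -/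
def pbT (B D : ℝ × ℝ → ℂ) (p : ℝ × ℝ) : ℂ :=
  fderiv ℝ B p (1, 0) * fderiv ℝ D p (0, 1) - fderiv ℝ D p (1, 0) * fderiv ℝ B p (0, 1)

/-- {M₁, N₂}: 4×4 matrix whose ((i,k),(j,l)) entry is the bracket of M_{ij} with N_{kl}. -/
def matPBS (M N : ℝ × ℝ → Matrix (Fin 2) (Fin 2) ℂ) (p : ℝ × ℝ) :
    Matrix (Fin 2 × Fin 2) (Fin 2 × Fin 2) ℂ :=
  Matrix.of fun ik jl => pbS (fun w => M w ik.1 jl.1) (fun w => N w ik.2 jl.2) p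

def matPBT (M N : ℝ × ℝ → Matrix (Fin 2) (Fin 2) ℂ) (p : ℝ × ℝ) :
    Matrix (Fin 2 × Fin 2) (Fin 2 × Fin 2) ℂ :=
  Matrix.of fun ik jl => pbT (fun w => M w ik.1 jl.1) (fun w => N w ik.2 jl.2) p

/-- trigonometric sine-Gordon classical r-matrix. -/
def rSG (β : ℝ) (lam mu : ℂ) : Matrix (Fin 2 × Fin 2) (Fin 2 × Fin 2) ℂ :=
  (-((β : ℂ) ^ 2 / 16) * (lam ^ 2 + mu ^ 2) / (lam ^ 2 - mu ^ 2)) • (I2 ⊗ₖ I2 - σ3 ⊗ₖ σ3)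
    + (((β : ℂ) ^ 2 / 8) * lam * mu / (lam ^ 2 - mu ^ 2)) • (σ1 ⊗ₖ σ1 + σ2 ⊗ₖ σ2)

/-- Partial derivatives of `a sin(βφ/2) + b cos(βφ/2) + c ψ`. -/
theorem fderiv_entry (β : ℝ) (a b c : ℂ) (p v : ℝ × ℝ) :
    fderiv ℝ (fun w : ℝ × ℝ => a * (Real.sin (β * w.1 / 2) : ℂ)
      + b * (Real.cos (β * w.1 / 2) : ℂ) + c * (w.2 : ℂ)) p v
      = (a * (Real.cos (β * p.1 / 2) : ℂ) - b * (Real.sin (β * p.1 / 2) : ℂ)) * (β / 2) * v.1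
        + c * v.2 := by
  have h1 : HasFDerivAt (fun w : ℝ × ℝ => β * w.1 / 2)
      ((β / 2) • ContinuousLinearMap.fst ℝ ℝ ℝ) p := by
    have := (hasFDerivAt_fst (𝕜 := ℝ) (p := p)).const_mul (β / 2)
    refine this.congr_of_eventuallyEq (Filter.Eventually.of_forall fun w => ?_)
    simp only []
    ring
  have hs := (Complex.ofRealCLM.hasFDerivAt.comp p h1.sin).const_mul a
  have hc := (Complex.ofRealCLM.hasFDerivAt.comp p h1.cos).const_mul b
  have h2 := (Complex.ofRealCLM.hasFDerivAt.comp p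
    (hasFDerivAt_snd (𝕜 := ℝ) (p := p))).const_mul c
  have H := ((hs.add hc).add h2).fderiv
  refine (congrArg (fun L : ℝ × ℝ →L[ℝ] ℂ => L v) H).trans ?_
  simp
  ring

/-- The common shape of both Lax matrices. -/
def LaxShape (β : ℝ) (a b : ℂ) (w : ℝ × ℝ) : Matrix (Fin 2) (Fin 2) ℂ :=
  (-Complex.I * a * Real.sin (β * w.1 / 2)) • σ1
    + (-Complex.I * b * Real.cos (β * w.1 / 2)) • σ2
    + (-Complex.I * (β / 4) * w.2) • σ3

theorem fderiv_LaxShape (β : ℝ) (a b : ℂ) (i j : Fin 2) (p v : ℝ × ℝ) :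
    fderiv ℝ (fun w => LaxShape β a b w i j) p v
      = (-Complex.I * a * σ1 i j * (Real.cos (β * p.1 / 2) : ℂ)
          - -Complex.I * b * σ2 i j * (Real.sin (β * p.1 / 2) : ℂ)) * (β / 2) * v.1
        + -Complex.I * (β / 4) * σ3 i j * v.2 := by
  rw [← fderiv_entry]
  congr 2
  funext w
  simp only [LaxShape, Matrix.add_apply, Matrix.smul_apply, smul_eq_mul]
  ring

/-- The key algebraic identity, for coefficients satisfying the two needed relations. -/
theorem key (β : ℝ) (a b a₂ b₂ f g : ℂ) (p : ℝ × ℝ)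
    (e1 : β ^ 2 / 8 * a = -2 * f * b - 2 * g * b₂)
    (e2 : β ^ 2 / 8 * b = -2 * f * a - 2 * g * a₂)
    (e3 : β ^ 2 / 8 * a₂ = 2 * f * b₂ + 2 * g * b)
    (e4 : β ^ 2 / 8 * b₂ = 2 * f * a₂ + 2 * g * a) :
    matPBT (LaxShape β a b) (LaxShape β a₂ b₂) p
      = (f • (I2 ⊗ₖ I2 - σ3 ⊗ₖ σ3) + g • (σ1 ⊗ₖ σ1 + σ2 ⊗ₖ σ2))
          * (LaxShape β a b p ⊗ₖ I2 + I2 ⊗ₖ LaxShape β a₂ b₂ p)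
        - (LaxShape β a b p ⊗ₖ I2 + I2 ⊗ₖ LaxShape β a₂ b₂ p)
          * (f • (I2 ⊗ₖ I2 - σ3 ⊗ₖ σ3) + g • (σ1 ⊗ₖ σ1 + σ2 ⊗ₖ σ2)) := by
  have hI : Complex.I ^ 2 = -1 := Complex.I_sq
  have hI3 : Complex.I ^ 3 = -Complex.I := Complex.I_pow_three
  ext ⟨i, k⟩ ⟨j, l⟩
  simp only [matPBT, pbT, Matrix.of_apply, fderiv_LaxShape]
  generalize hS : ((Real.sin (β * p.1 / 2) : ℝ) : ℂ) = S
  generalize hC : ((Real.cos (β * p.1 / 2) : ℝ) : ℂ) = C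
  fin_cases i <;> fin_cases k <;> fin_cases j <;> fin_cases l <;>
    simp [Matrix.mul_apply, Fintype.sum_prod_type, LaxShape, σ1, σ2, σ3, I2,
      -Complex.ofReal_sin, -Complex.ofReal_cos, hS, hC] <;> ring_nf <;> (try simp only [hI]) <;> ring_nf
  all_goals rw [hI3]
  all_goals first
    | linear_combination C * e1 + Complex.I * S * e2
    | linear_combination C * e1 - Complex.I * S * e2
    | linear_combination -C * e1 + Complex.I * S * e2
    | linear_combination -C * e1 - Complex.I * S * e2
    | linear_combination C * e3 + Complex.I * S * e4
    | linear_combination C * e3 - Complex.I * S * e4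
    | linear_combination -C * e3 + Complex.I * S * e4
    | linear_combination -C * e3 - Complex.I * S * e4

/-- Covariant r-matrix structure for sine-Gordon: the dx-component (−{U₁,U₂}_S) and the
dt-component ({V₁,V₂}_T) of the covariant Poisson bracket of the Lax form are both given
by the commutator with the classical r-matrix. -/
theorem covariant_r_matrix_SG (m β : ℝ) (hβ : β ≠ 0) (φ φt φx : ℝ) (lam mu : ℂ)
    (hlam : lam ≠ 0) (hmu : mu ≠ 0) (h : lam ^ 2 ≠ mu ^ 2) :
    matPBS (USG m β lam) (USG m β mu) (φ, φt)
      = -(rSG β lam mu * (USG m β lam (φ, φt) ⊗ₖ I2 + I2 ⊗ₖ USG m β mu (φ, φt))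
          - (USG m β lam (φ, φt) ⊗ₖ I2 + I2 ⊗ₖ USG m β mu (φ, φt)) * rSG β lam mu)
    ∧ matPBT (VSG m β lam) (VSG m β mu) (φ, φx)
      = rSG β lam mu * (VSG m β lam (φ, φx) ⊗ₖ I2 + I2 ⊗ₖ VSG m β mu (φ, φx))
          - (VSG m β lam (φ, φx) ⊗ₖ I2 + I2 ⊗ₖ VSG m β mu (φ, φx)) * rSG β lam mu := by
  have hd : lam ^ 2 - mu ^ 2 ≠ 0 := sub_ne_zero.mpr h
  have hST : ∀ (M N : ℝ × ℝ → Matrix (Fin 2) (Fin 2) ℂ) (p : ℝ × ℝ),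
      matPBS M N p = -matPBT M N p := by
    intro M N p
    ext ik jl
    simp only [matPBS, matPBT, pbS, pbT, Matrix.of_apply, Matrix.neg_apply]
    ring
  constructor
  · rw [hST]
    refine congrArg Neg.neg
      (key β (k0 m lam) (k1 m lam) (k0 m mu) (k1 m mu) _ _ (φ, φt) ?_ ?_ ?_ ?_) <;>
    · simp only [k0, k1]
      field_simp
      ring
  · refine key β (k1 m lam) (k0 m lam) (k1 m mu) (k0 m mu) _ _ (φ, φx) ?_ ?_ ?_ ?_ <;>
    · simp only [k0, k1]
      field_simp
      ring
end
end

section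
/- (Sklyanin relation for the sine-Gordon space Lax matrix.) For all real (φ, φ_t) and all λ, μ ∈ ℂ with λ ≠ 0, μ ≠ 0 and λ² ≠ μ², the 4×4 matrix identity {U₁(φ,φ_t;λ), U₂(φ,φ_t;μ)}_S = −[r₁₂(λ,μ), U(φ,φ_t;λ)⊗I + I⊗U(φ,φ_t;μ)] holds. -/
noncomputable section

open Matrix Kronecker

/-- Derivative of the generic entry of the Lax matrix. -/
theorem entry_fderiv (β : ℝ) (x y z : ℂ) (φ φt : ℝ) (v : ℝ × ℝ) :
    fderiv ℝ (fun w : ℝ × ℝ => x * (Real.sin (β * w.1 / 2) : ℂ)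
      + y * (Real.cos (β * w.1 / 2) : ℂ) + z * (w.2 : ℂ)) (φ, φt) v
    = (x * (Real.cos (β * φ / 2) : ℂ) - y * (Real.sin (β * φ / 2) : ℂ)) * (β / 2) * v.1
      + z * v.2 := by
  have h1 : HasFDerivAt (fun w : ℝ × ℝ => β * w.1 / 2)
      ((β / 2) • ContinuousLinearMap.fst ℝ ℝ ℝ) (φ, φt) := by
    have := ((ContinuousLinearMap.fst ℝ ℝ ℝ).hasFDerivAt (x := (φ, φt))).const_mul (β / 2)
    refine this.congr_of_eventuallyEq (Filter.Eventually.of_forall fun w => ?_)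
    simp only [ContinuousLinearMap.coe_fst']
    ring
  have hs := (Complex.ofRealCLM.hasFDerivAt.comp (φ, φt) h1.sin).const_mul x
  have hc := (Complex.ofRealCLM.hasFDerivAt.comp (φ, φt) h1.cos).const_mul y
  have ht := (Complex.ofRealCLM.hasFDerivAt.comp (φ, φt)
    ((ContinuousLinearMap.snd ℝ ℝ ℝ).hasFDerivAt (x := (φ, φt)))).const_mul z
  have hh := (hs.add hc).add ht
  have e := hh.fderiv
  have e2 := congrArg (fun L => L v) e
  refine Eq.trans e2 ?_
  simp
  ring

theorem USG_entry (m β : ℝ) (lam : ℂ) (i j : Fin 2) :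
    (fun w => USG m β lam w i j) = fun w : ℝ × ℝ =>
      (-Complex.I * k0 m lam * σ1 i j) * (Real.sin (β * w.1 / 2) : ℂ)
      + (-Complex.I * k1 m lam * σ2 i j) * (Real.cos (β * w.1 / 2) : ℂ)
      + (-Complex.I * (β / 4) * σ3 i j) * (w.2 : ℂ) := by
  funext w
  simp only [USG, Matrix.add_apply, Matrix.smul_apply, smul_eq_mul]
  ring

/-- Sklyanin relation for the sine-Gordon space Lax matrix. -/
theorem sklyanin_SG_U (m β : ℝ) (hβ : β ≠ 0) (φ φt : ℝ) (lam mu : ℂ)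
    (hlam : lam ≠ 0) (hmu : mu ≠ 0) (h : lam ^ 2 ≠ mu ^ 2) :
    matPBS (USG m β lam) (USG m β mu) (φ, φt)
      = -(rSG β lam mu * (USG m β lam (φ, φt) ⊗ₖ I2 + I2 ⊗ₖ USG m β mu (φ, φt))
          - (USG m β lam (φ, φt) ⊗ₖ I2 + I2 ⊗ₖ USG m β mu (φ, φt)) * rSG β lam mu) := by
  have hd : lam ^ 2 - mu ^ 2 ≠ 0 := sub_ne_zero.mpr h
  ext ⟨i, k⟩ ⟨j, l⟩
  simp only [matPBS, Matrix.of_apply, pbS, USG_entry, entry_fderiv]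
  simp only [USG, rSG, k0, k1]
  generalize (Real.sin (β * φ / 2) : ℂ) = s
  generalize (Real.cos (β * φ / 2) : ℂ) = c
  have hI : Complex.I ^ 2 = -1 := Complex.I_sq
  have hI3 : Complex.I ^ 3 = -Complex.I := by rw [pow_succ, hI]; ring
  have hI4 : Complex.I ^ 4 = 1 := Complex.I_pow_four
  fin_cases i <;> fin_cases j <;> fin_cases k <;> fin_cases l <;>
    simp [Matrix.mul_apply, Fintype.sum_prod_type, Fin.sum_univ_two, σ1, σ2, σ3, I2,
      Matrix.kroneckerMap_apply] <;>
    field_simp <;> ring_nf <;> (try simp only [hI, hI3, hI4]) <;> ring_nf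
end
end

section
/- (Dual Sklyanin relation for the sine-Gordon time Lax matrix.) For all real (φ, φ_x) and all λ, μ ∈ ℂ with λ ≠ 0, μ ≠ 0 and λ² ≠ μ², the 4×4 matrix identity {V₁(φ,φ_x;λ), V₂(φ,φ_x;μ)}_T = [r₁₂(λ,μ), V(φ,φ_x;λ)⊗I + I⊗V(φ,φ_x;μ)] holds. -/
noncomputable section

open Matrix Kronecker

lemma VSG_fderiv_fst (m β : ℝ) (lam : ℂ) (p : ℝ × ℝ) (i j : Fin 2) :
    fderiv ℝ (fun w => VSG m β lam w i j) p (1, 0) =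
      (-Complex.I * k1 m lam * (Real.cos (β * p.1 / 2) * (β / 2))) * σ1 i j
      + (-Complex.I * k0 m lam * (-Real.sin (β * p.1 / 2) * (β / 2))) * σ2 i j ∧
    fderiv ℝ (fun w => VSG m β lam w i j) p (0, 1) =
      (-Complex.I * (β / 4)) * σ3 i j := by
  have h1 : HasFDerivAt (fun w : ℝ × ℝ => β * w.1 / 2)
      ((β / 2) • ContinuousLinearMap.fst ℝ ℝ ℝ) p := by
    have := (hasFDerivAt_fst (𝕜 := ℝ) (p := p)).const_mul (β / 2)
    refine this.congr_of_eventuallyEq (Filter.Eventually.of_forall fun w => ?_)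
    simp only []
    ring
  have hs := Complex.ofRealCLM.hasFDerivAt.comp p h1.sin
  have hc := Complex.ofRealCLM.hasFDerivAt.comp p h1.cos
  have hx := Complex.ofRealCLM.hasFDerivAt.comp p (hasFDerivAt_snd (𝕜 := ℝ) (p := p))
  have H := (((hs.const_mul (-Complex.I * k1 m lam)).mul_const (σ1 i j)).add
    ((hc.const_mul (-Complex.I * k0 m lam)).mul_const (σ2 i j))).add
    ((hx.const_mul (-Complex.I * (β / 4))).mul_const (σ3 i j))
  have H2 := H.congr_of_eventuallyEq (f₁ := fun w => VSG m β lam w i j)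
    (Filter.Eventually.of_forall fun w => by simp [VSG])
  rw [H2.fderiv]
  constructor
  · simp
    ring
  · simp
    try ring

/-- Dual Sklyanin relation for the sine-Gordon time Lax matrix. -/
theorem sklyanin_SG_V (m β : ℝ) (hβ : β ≠ 0) (φ φx : ℝ) (lam mu : ℂ)
    (hlam : lam ≠ 0) (hmu : mu ≠ 0) (h : lam ^ 2 ≠ mu ^ 2) :
    matPBT (VSG m β lam) (VSG m β mu) (φ, φx)
      = rSG β lam mu * (VSG m β lam (φ, φx) ⊗ₖ I2 + I2 ⊗ₖ VSG m β mu (φ, φx))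
          - (VSG m β lam (φ, φx) ⊗ₖ I2 + I2 ⊗ₖ VSG m β mu (φ, φx)) * rSG β lam mu := by
  have hd : lam ^ 2 - mu ^ 2 ≠ 0 := sub_ne_zero.mpr h
  have hI : Complex.I ^ 2 = -1 := Complex.I_sq
  ext ⟨i, k⟩ ⟨j, l⟩
  simp only [matPBT, Matrix.of_apply, pbT, (VSG_fderiv_fst _ _ _ _ _ _).1,
    (VSG_fderiv_fst _ _ _ _ _ _).2]
  generalize hS : Real.sin (β * φ / 2) = S
  generalize hC : Real.cos (β * φ / 2) = C
  fin_cases i <;> fin_cases k <;> fin_cases j <;> fin_cases l <;>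
    simp [VSG, rSG, I2, σ1, σ2, σ3, k0, k1, Matrix.mul_apply, Fintype.sum_prod_type, hS, hC,
      -Complex.ofReal_sin, -Complex.ofReal_cos] <;>
    (try field_simp) <;> (try ring_nf) <;> (try simp only [hI]) <;> (try ring_nf)
end
end

section
/- (Covariant Hamilton equation for NLS.) Let q, r : ℝ² → ℂ (coordinates (x,t)) be twice continuously differentiable. Define U(x,t;λ) = U(q(x,t), r(x,t); λ) and V(x,t;λ) = V(q(x,t), r(x,t), ∂_x q(x,t), ∂_x r(x,t); λ). Then the covariant Hamilton equation ∂_x V(x,t;λ) − ∂_t U(x,t;λ) = (2i q²r + λ ∂_x q) σ₊ + (−2i q r² + λ ∂_x r) σ₋ − i((∂_x q) r + q (∂_x r)) σ₃ holds for all (x,t) ∈ ℝ² and all λ ∈ ℂ if and only if q, r satisfy the nonlinear Schrödinger system i·∂_t q + ∂_x²q − 2q²r = 0 and i·∂_t r − ∂_x²r + 2r²q = 0 on all of ℝ². -/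
noncomputable section

open Matrix

def σp : Matrix (Fin 2) (Fin 2) ℂ := !![0, 1; 0, 0]
def σm : Matrix (Fin 2) (Fin 2) ℂ := !![0, 0; 1, 0]

/-- AKNS space Lax matrix U(q, r; λ). -/
def Uak (q r lam : ℂ) : Matrix (Fin 2) (Fin 2) ℂ :=
  (-(Complex.I * lam) / 2) • σ3 + q • σp + r • σm

/-- NLS time Lax matrix V(q, r, q_x, r_x; λ). -/
def Vnls (q r qx rx lam : ℂ) : Matrix (Fin 2) (Fin 2) ℂ :=
  (lam ^ 2 / (2 * Complex.I) - Complex.I * q * r) • σ3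
    + (lam * q + Complex.I * qx) • σp + (lam * r - Complex.I * rx) • σm

/-- x-derivative of a complex-valued function on ℝ², coordinates (x,t). -/
def dx (f : ℝ × ℝ → ℂ) (w : ℝ × ℝ) : ℂ := fderiv ℝ f w (1, 0)

/-- t-derivative of a complex-valued function on ℝ², coordinates (x,t). -/
def dt (f : ℝ × ℝ → ℂ) (w : ℝ × ℝ) : ℂ := fderiv ℝ f w (0, 1)

/-- Entrywise directional derivative of a matrix-valued function on ℝ². -/
def mderiv (F : ℝ × ℝ → Matrix (Fin 2) (Fin 2) ℂ) (p v : ℝ × ℝ) :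
    Matrix (Fin 2) (Fin 2) ℂ :=
  Matrix.of fun i j => fderiv ℝ (fun w => F w i j) p v

theorem aux_dV (q r : ℝ × ℝ → ℂ) (hq : ContDiff ℝ 2 q) (hr : ContDiff ℝ 2 r)
    (p : ℝ × ℝ) (lam : ℂ) :
    mderiv (fun w => Vnls (q w) (r w) (dx q w) (dx r w) lam) p (1, 0)
      = !![-Complex.I * (dx q p * r p + q p * dx r p), lam * dx q p + Complex.I * dx (dx q) p;
          lam * dx r p - Complex.I * dx (dx r) p,
          Complex.I * (dx q p * r p + q p * dx r p)] := by
  have hq1 : HasFDerivAt q (fderiv ℝ q p) p :=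
    (hq.differentiable (by norm_num) p).hasFDerivAt
  have hr1 : HasFDerivAt r (fderiv ℝ r p) p :=
    (hr.differentiable (by norm_num) p).hasFDerivAt
  have key : ∀ f : ℝ × ℝ → ℂ, ContDiff ℝ 2 f →
      HasFDerivAt (dx f) (fderiv ℝ (dx f) p) p := by
    intro f hf
    have h1 : ContDiff ℝ 1 (fderiv ℝ f) := hf.fderiv_right (by norm_num)
    have h2 : ContDiff ℝ 1 (dx f) := h1.clm_apply contDiff_const
    exact (h2.differentiable (by norm_num) p).hasFDerivAt
  have hq2 := key q hq
  have hr2 := key r hr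
  have hd := ((hq1.const_mul Complex.I).mul hr1).const_sub (lam ^ 2 / (2 * Complex.I))
  have hp := (hq1.const_mul lam).add (hq2.const_mul Complex.I)
  have hm := (hr1.const_mul lam).sub (hr2.const_mul Complex.I)
  ext i j
  fin_cases i <;> fin_cases j
  · have e : (fun w => Vnls (q w) (r w) (dx q w) (dx r w) lam 0 0)
        = fun w => lam ^ 2 / (2 * Complex.I) - Complex.I * q w * r w := by
      funext w; simp [Vnls, σ3, σp, σm]
    have e2 := congrArg (fun L => L ((1, 0) : ℝ × ℝ)) hd.fderiv
    simp [mderiv, e]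
    refine Eq.trans e2 ?_
    simp [dx]; ring
  · have e : (fun w => Vnls (q w) (r w) (dx q w) (dx r w) lam 0 1)
        = fun w => lam * q w + Complex.I * dx q w := by
      funext w; simp [Vnls, σ3, σp, σm]
    have e2 := congrArg (fun L => L ((1, 0) : ℝ × ℝ)) hp.fderiv
    simp [mderiv, e]
    refine Eq.trans e2 ?_
    simp [dx]
  · have e : (fun w => Vnls (q w) (r w) (dx q w) (dx r w) lam 1 0)
        = fun w => lam * r w - Complex.I * dx r w := by
      funext w; simp [Vnls, σ3, σp, σm]
    have e2 := congrArg (fun L => L ((1, 0) : ℝ × ℝ)) hm.fderiv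
    simp [mderiv, e]
    refine Eq.trans e2 ?_
    simp [dx]
  · have e : (fun w => Vnls (q w) (r w) (dx q w) (dx r w) lam 1 1)
        = fun w => -(lam ^ 2 / (2 * Complex.I) - Complex.I * q w * r w) := by
      funext w; simp [Vnls, σ3, σp, σm]
    have e2 := congrArg (fun L => L ((1, 0) : ℝ × ℝ)) hd.neg.fderiv
    simp only [mderiv, Matrix.of_apply, Fin.mk_one, e]
    refine Eq.trans e2 ?_
    simp [dx]; ring

theorem aux_dU (q r : ℝ × ℝ → ℂ) (p : ℝ × ℝ) (lam : ℂ) :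
    mderiv (fun w => Uak (q w) (r w) lam) p (0, 1) = !![0, dt q p; dt r p, 0] := by
  ext i j
  fin_cases i <;> fin_cases j <;> simp [mderiv, Uak, σ3, σp, σm, dt]

/-- Covariant Hamilton equation for NLS: ∂_x V − ∂_t U = {H, W(λ)} holds for all (x,t)
and all λ iff (q, r) solve the nonlinear Schrödinger system. -/
theorem covariant_Hamilton_NLS (q r : ℝ × ℝ → ℂ)
    (hq : ContDiff ℝ 2 q) (hr : ContDiff ℝ 2 r) :
    (∀ p : ℝ × ℝ, ∀ lam : ℂ,
      mderiv (fun w => Vnls (q w) (r w) (dx q w) (dx r w) lam) p (1, 0)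
        - mderiv (fun w => Uak (q w) (r w) lam) p (0, 1)
        = (2 * Complex.I * (q p) ^ 2 * r p + lam * dx q p) • σp
          + (-2 * Complex.I * q p * (r p) ^ 2 + lam * dx r p) • σm
          + (-Complex.I * (dx q p * r p + q p * dx r p)) • σ3)
    ↔ (∀ p : ℝ × ℝ,
        Complex.I * dt q p + dx (dx q) p - 2 * (q p) ^ 2 * r p = 0
        ∧ Complex.I * dt r p - dx (dx r) p + 2 * (r p) ^ 2 * q p = 0) := by
  refine forall_congr' fun p => ?_
  have hI := Complex.I_mul_I
  constructor
  · intro h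
    have h0 := h 0
    rw [aux_dV q r hq hr, aux_dU] at h0
    have h1 := congrFun (congrFun h0 0) 1
    have h2 := congrFun (congrFun h0 1) 0
    simp [σ3, σp, σm] at h1 h2
    constructor
    · linear_combination (-Complex.I) * h1 + (dx (dx q) p - 2 * (q p) ^ 2 * r p) * hI
    · linear_combination (-Complex.I) * h2 - (dx (dx r) p - 2 * (r p) ^ 2 * q p) * hI
  · rintro ⟨h1, h2⟩ lam
    rw [aux_dV q r hq hr, aux_dU]
    ext i j
    fin_cases i <;> fin_cases j <;> simp [σ3, σp, σm]
    · linear_combination Complex.I * h1 - dt q p * hI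
    · linear_combination Complex.I * h2 - dt r p * hI
end
end
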